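/- Let n ≥ 0. Then: (i) for every Σ_{n+1}-invariant Hochschild cocycle φ ∈ CS^n(k_3G,k_3G), the cochain 𝔹_G^n(φ) = r_{ι_G} ∘ δ^n_{k_2G}(s_{π_G} ∘ φ) lies in CS^{n+1}(k_1G,k_1G), is a cocycle, and its class depends only on [φ], so that [φ] ↦ [𝔹_G^n(φ)] is a well-defined group homomorphism 𝔹_G^n : HHS^n(k_3G) → HHS^{n+1}(k_1G) (the connecting homomorphism in symmetric Hochschild cohomology); (ii) for every x ∈ G the square commutes: π^{n+1,S}_{G,x} ∘ 𝔹_G^n = β^{n,S}_{C_G(x)} ∘ π^{n,S}_{G,x} as maps HHS^n(k_3G) → HS^{n+1}(C_G(x), k_1x). -/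

import Mathlib

/- Common setup: twisted group algebras modelled on their canonical basis.
An element of the twisted group algebra `k_αG` is modelled as a function `G → k`
(its coordinates in the basis `{ḡ : g ∈ G}`), and a Hochschild `n`-cochain
`Hom_k((k_αG)^{⊗n}, M)` is modelled by its values on basis tensors, i.e. as a
function `(Fin n → G) → M`.  Similarly a group cochain `C^n(H, A)` is a function
`(Fin n → H) → A`; the one-dimensional module `k x̄` is modelled as `k` with the
action of `h` given by multiplication by the character `χ(h) = α(h,x)·α(x,h)⁻¹`. -/

namespace TwistedSym

section Defs

variable {k : Type*} [CommRing k] {G : Type*} [Group G] [DecidableEq G]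
variable {M : Type*} [AddCommGroup M] [Module k M]
variable {H : Type*} [Group H]
variable {A : Type*} [AddCommGroup A] [DistribMulAction H A]

/-- The 2-cocycle condition `α(x,yz)α(y,z) = α(xy,z)α(x,y)`. -/
def IsCocycle (α : G → G → kˣ) : Prop :=
  ∀ x y z : G, α x (y * z) * α y z = α (x * y) z * α x y

/-- Normalization `α(1,x) = α(x,1) = 1`. -/
def IsNormalized (α : G → G → kˣ) : Prop :=
  ∀ x : G, α 1 x = 1 ∧ α x 1 = 1

/-- `(L, R)` encode a `(k_αG, k_αG)`-bimodule structure on the `k`-module `M`: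
`L g` is left multiplication by the basis element `ḡ` and `R g` is right
multiplication by `ḡ`. -/
def IsBimodule (α : G → G → kˣ) (L R : G → M →ₗ[k] M) : Prop :=
  (∀ m : M, L 1 m = m) ∧ (∀ m : M, R 1 m = m) ∧
  (∀ (g h : G) (m : M), L g (L h m) = (α g h : k) • L (g * h) m) ∧
  (∀ (g h : G) (m : M), R h (R g m) = (α g h : k) • R (g * h) m) ∧
  (∀ (g h : G) (m : M), L g (R h m) = R h (L g m))

/-- The tuple of group elements appearing in the action of the transposition
`σ_{i0+1} = (i0+1, i0+2)` on `n`-cochains (0-indexed `i0 : Fin n`):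
position `i0 - 1` gets `g_{i0-1}·g_{i0}`, position `i0` gets `g_{i0}⁻¹` and
position `i0 + 1` gets `g_{i0}·g_{i0+1}` (when these positions exist). -/
def swapTuple {n : ℕ} (i0 : Fin n) (g : Fin n → H) : Fin n → H := fun j =>
  if (j : ℕ) + 1 = (i0 : ℕ) then g j * g i0
  else if j = i0 then (g i0)⁻¹
  else if (j : ℕ) = (i0 : ℕ) + 1 then g i0 * g j
  else g j

/-- The action of the transposition `σ_{i0+1} = (i0+1,i0+2) ∈ Σ_{n+1}` on Hochschild
`n`-cochains of the twisted group algebra `k_αG` with coefficients in the bimodule `M`.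
All the `α`-scalars come from rewriting products and inverses of basis elements in
terms of basis elements: `ḡ·h̄ = α(g,h)·(gh)‾` and `ḡ⁻¹ = α(g,g⁻¹)⁻¹·(g⁻¹)‾`. -/
def hSigma (α : G → G → kˣ) (L R : G → M →ₗ[k] M) {n : ℕ} (i0 : Fin n)
    (φ : (Fin n → G) → M) : (Fin n → G) → M := fun g =>
  -(((if 0 < (i0 : ℕ) then
        (α (g ⟨(i0 : ℕ) - 1, lt_of_le_of_lt (Nat.sub_le _ _) i0.isLt⟩) (g i0) : k) else 1) *
     (((α (g i0) (g i0)⁻¹)⁻¹ : kˣ) : k) *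
     (if h : (i0 : ℕ) + 1 < n then (α (g i0) (g ⟨(i0 : ℕ) + 1, h⟩) : k) else 1)) •
    (if (i0 : ℕ) = 0 then
        L (g i0) (if (i0 : ℕ) + 1 = n then R (g i0) (φ (swapTuple i0 g)) else φ (swapTuple i0 g))
      else (if (i0 : ℕ) + 1 = n then R (g i0) (φ (swapTuple i0 g)) else φ (swapTuple i0 g))))

/-- Staic's action of the transposition `σ_{i0+1} ∈ Σ_{n+1}` on group `n`-cochains
with values in an `H`-module `A`. -/
def gSigma {n : ℕ} (i0 : Fin n) (ψ : (Fin n → H) → A) : (Fin n → H) → A := fun h =>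
  -(if (i0 : ℕ) = 0 then h i0 • ψ (swapTuple i0 h) else ψ (swapTuple i0 h))

/-- Staic's action of the transposition `σ_{i0+1} ∈ Σ_{n+1}` on group `n`-cochains
with values in the rank-one module `k` on which `H` acts through the character `χ`. -/
def cSigma (χ : H → k) {n : ℕ} (i0 : Fin n) (ψ : (Fin n → H) → k) : (Fin n → H) → k := fun h =>
  -(if (i0 : ℕ) = 0 then χ (h i0) * ψ (swapTuple i0 h) else ψ (swapTuple i0 h))

/-- The `(n+1)`-tuple `g` with entries at positions `j, j+1` multiplied together. -/
def mergeAt {n : ℕ} (g : Fin (n + 1) → H) (j : Fin n) : Fin n → H := fun l =>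
  if (l : ℕ) < (j : ℕ) then g (Fin.castSucc l)
  else if l = j then g (Fin.castSucc l) * g (Fin.succ l)
  else g (Fin.succ l)

/-- The Hochschild differential `δ^n` for the twisted group algebra `k_αG` with
coefficients in the bimodule `M`, written on basis tensors (the scalar
`α(g_j, g_{j+1})` comes from `ḡ_j·ḡ_{j+1} = α(g_j,g_{j+1})·(g_jg_{j+1})‾`). -/
def hDiff (α : G → G → kˣ) (L R : G → M →ₗ[k] M) {n : ℕ}
    (φ : (Fin n → G) → M) : (Fin (n + 1) → G) → M := fun g =>
  L (g 0) (φ fun j => g j.succ)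
    + ∑ j : Fin n, ((-1 : ℤ) ^ ((j : ℕ) + 1)) •
        ((α (g j.castSucc) (g j.succ) : k) • φ (mergeAt g j))
    + ((-1 : ℤ) ^ (n + 1)) • R (g (Fin.last n)) (φ fun j => g j.castSucc)

/-- The group cohomology differential `∂^n` for cochains on `H` with values in the
`H`-module `A`. -/
def gDiff {n : ℕ} (ψ : (Fin n → H) → A) : (Fin (n + 1) → H) → A := fun h =>
  h 0 • ψ (fun j => h j.succ)
    + ∑ j : Fin n, ((-1 : ℤ) ^ ((j : ℕ) + 1)) • ψ (mergeAt h j)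
    + ((-1 : ℤ) ^ (n + 1)) • ψ (fun j => h j.castSucc)

/-- The group cohomology differential `∂^n` for cochains on `H` with values in the
rank-one module `k` on which `H` acts through the character `χ`. -/
def cDiff (χ : H → k) {n : ℕ} (ψ : (Fin n → H) → k) : (Fin (n + 1) → H) → k := fun h =>
  χ (h 0) * ψ (fun j => h j.succ)
    + ∑ j : Fin n, ((-1 : ℤ) ^ ((j : ℕ) + 1)) • ψ (mergeAt h j)
    + ((-1 : ℤ) ^ (n + 1)) • ψ (fun j => h j.castSucc)

/-- Left multiplication by the basis element `ḡ` on `k_αG` (modelled as `G → k`). -/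
def Lmul (α : G → G → kˣ) (g : G) : (G → k) →ₗ[k] (G → k) where
  toFun a := fun y => (α g (g⁻¹ * y) : k) * a (g⁻¹ * y)
  map_add' a b := by funext y; simp [mul_add]
  map_smul' c a := by funext y; simp [smul_eq_mul]; ring

/-- Right multiplication by the basis element `ḡ` on `k_αG` (modelled as `G → k`). -/
def Rmul (α : G → G → kˣ) (g : G) : (G → k) →ₗ[k] (G → k) where
  toFun a := fun y => (α (y * g⁻¹) g : k) * a (y * g⁻¹)
  map_add' a b := by funext y; simp [mul_add]
  map_smul' c a := by funext y; simp [smul_eq_mul]; ring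

/-- Iterated right multiplication: `rmuls α [g₁,…,gₙ] v = v·ḡ₁·…·ḡₙ`. -/
def rmuls (α : G → G → kˣ) (l : List G) (v : G → k) : G → k :=
  l.foldl (fun w g => Rmul α g w) v

/-- Iterated right multiplication by inverses of basis elements:
`rinvs α [h₁,…,hₙ] v = v·h̄ₙ⁻¹·…·h̄₁⁻¹`, using `h̄⁻¹ = α(h,h⁻¹)⁻¹·(h⁻¹)‾`. -/
def rinvs (α : G → G → kˣ) (l : List G) (v : G → k) : G → k :=
  l.foldr (fun h w => (((α h h⁻¹)⁻¹ : kˣ) : k) • Rmul α h⁻¹ w) v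

/-- The character through which `h ∈ C_G(x)` acts on the module `k x̄`:
`χ(h) = α(h,x)·α(x,h)⁻¹`. -/
def chi (α : G → G → kˣ) (x : G) : G → k := fun h =>
  (α h x : k) * (((α x h)⁻¹ : kˣ) : k)

/-- The map `π^n_{G,x,α} : C^n(k_αG, k_αG) → C^n(C_G(x), k x̄)`: the value on
`(h₁,…,hₙ)` is the coefficient of the basis element `x̄` in
`φ(h̄₁⊗…⊗h̄ₙ)·h̄ₙ⁻¹·…·h̄₁⁻¹` (identifying `k x̄` with `k`). -/
def piC (α : G → G → kˣ) (x : G) {n : ℕ} (φ : (Fin n → G) → (G → k)) :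
    (Fin n → Subgroup.centralizer ({x} : Set G)) → k := fun h =>
  rinvs α (List.ofFn fun i => (h i : G)) (φ fun i => (h i : G)) x

/-- The same map as `piC` for a central element `x`, in which case `C_G(x) = G`:
`π^n_{G,x,α} : C^n(k_αG, k_αG) → C^n(G, k x̄)`. -/
def piZ (α : G → G → kˣ) (x : G) {n : ℕ} (φ : (Fin n → G) → (G → k)) :
    (Fin n → G) → k := fun h =>
  rinvs α (List.ofFn h) (φ h) x

/-- The map `ν^n_{G,x,α} : C^n(G, k x̄) → C^n(k_αG, k_αG)` for `x ∈ Z(G)`: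
`ψ ↦ (ḡ₁⊗…⊗ḡₙ ↦ ψ(g₁,…,gₙ)·x̄·ḡ₁·…·ḡₙ)` (identifying `k x̄` with `k`). -/
def nuZ (α : G → G → kˣ) (x : G) {n : ℕ} (ψ : (Fin n → G) → k) :
    (Fin n → G) → (G → k) := fun g =>
  ψ g • rmuls α (List.ofFn g) (Pi.single x 1)

/-- Iteration of the index map of a coset decomposition along a list of group
elements: `chainIdx idx j [g₁,…,gᵢ]` is the index `s_j^i`. -/
def chainIdx {m : ℕ} (idx : Fin m → G → Fin m) (j : Fin m) : List G → Fin m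
  | [] => j
  | a :: l => chainIdx idx (idx j a) l

/-- The map `ν^n_{G,x} : C^n(C_G(x), kx) → C^n(kG, kG)` for the (untwisted) group
algebra, relative to a right coset decomposition `G = ⋃ⱼ C_G(x)γⱼ`:
`ν(ψ)(g₁⊗…⊗gₙ) = Σⱼ ψ(h_{j,1},…,h_{j,n})·x⁻¹·xⱼ·g₁⋯gₙ` where
`xⱼ = γⱼ⁻¹xγⱼ`, the `h_{j,i} = rep (s_j^{i-1}) gᵢ ∈ C_G(x)` are determined by
`γ_{s_j^{i-1}}·gᵢ = h_{j,i}·γ_{s_j^i}` and `kx` is identified with `k`. -/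
def nuT (x : G) {m n : ℕ} (γ : Fin m → G) (idx : Fin m → G → Fin m)
    (rep : Fin m → G → G)
    (hrep : ∀ j a, rep j a ∈ Subgroup.centralizer ({x} : Set G))
    (ψ : (Fin n → Subgroup.centralizer ({x} : Set G)) → k) :
    (Fin n → G) → (G → k) := fun g =>
  ∑ j : Fin m,
    ψ (fun i => ⟨rep (chainIdx idx j ((List.ofFn g).take (i : ℕ))) (g i), hrep _ _⟩) •
      (Pi.single ((γ j)⁻¹ * x * γ j * (List.ofFn g).prod) (1 : k) : G → k)

/-- `φ` is a Hochschild coboundary (for `n = 0` the coboundary space is `0`). -/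
def IsHCoboundary (α : G → G → kˣ) (L R : G → M →ₗ[k] M) :
    ∀ {n : ℕ}, ((Fin n → G) → M) → Prop
  | 0, φ => φ = 0
  | _ + 1, φ => ∃ θ, φ = hDiff α L R θ

/-- `φ` is the Hochschild coboundary of a `Σ`-invariant cochain. -/
def IsHSCoboundary (α : G → G → kˣ) (L R : G → M →ₗ[k] M) :
    ∀ {n : ℕ}, ((Fin n → G) → M) → Prop
  | 0, φ => φ = 0
  | _ + 1, φ => ∃ θ, (∀ i0, hSigma α L R i0 θ = θ) ∧ φ = hDiff α L R θ

/-- `ψ` is a group-cohomology coboundary (coefficients in `k` through `χ`). -/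
def IsCCoboundary (χ : H → k) : ∀ {n : ℕ}, ((Fin n → H) → k) → Prop
  | 0, ψ => ψ = 0
  | _ + 1, ψ => ∃ θ, ψ = cDiff χ θ

/-- `ψ` is the coboundary of a `Σ`-invariant group cochain (coefficients through `χ`). -/
def IsCSCoboundary (χ : H → k) : ∀ {n : ℕ}, ((Fin n → H) → k) → Prop
  | 0, ψ => ψ = 0
  | _ + 1, ψ => ∃ θ, (∀ i0, cSigma χ i0 θ = θ) ∧ ψ = cDiff χ θ

/-- `ψ` is a group-cohomology coboundary (coefficients in the `H`-module `A`). -/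
def IsGCoboundary : ∀ {n : ℕ}, ((Fin n → H) → A) → Prop
  | 0, ψ => ψ = 0
  | _ + 1, ψ => ∃ θ, ψ = gDiff θ

/-- `ψ` is the coboundary of a `Σ`-invariant group cochain (coefficients in `A`). -/
def IsGSCoboundary : ∀ {n : ℕ}, ((Fin n → H) → A) → Prop
  | 0, ψ => ψ = 0
  | _ + 1, ψ => ∃ θ, (∀ i0, gSigma i0 θ = θ) ∧ ψ = gDiff θ

end Defs

section Homogeneous

variable {G : Type*} {A : Type*} [AddCommGroup A]

/-- The alternating face sum of a homogeneous cochain. -/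
def faceSum {n : ℕ} (F : (Fin n → G) → A) : (Fin (n + 1) → G) → A := fun x =>
  ∑ j : Fin (n + 1), ((-1 : ℤ) ^ (j : ℕ)) • F (x ∘ j.succAbove)

theorem faceSum_faceSum {n : ℕ} (F : (Fin n → G) → A) : faceSum (faceSum F) = 0 := by
  funext x
  simp only [faceSum, Finset.smul_sum, smul_smul, ← pow_add, Pi.zero_apply]
  rw [← Finset.sum_product' (f := fun (i : Fin (n + 2)) (j : Fin (n + 1)) =>
    ((-1 : ℤ) ^ ((i : ℕ) + (j : ℕ))) • F ((x ∘ i.succAbove) ∘ j.succAbove))]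
  refine Finset.sum_involution (fun p _ => (p.1.succAbove p.2, p.2.predAbove p.1)) ?_ ?_ ?_ ?_
  · rintro ⟨i, j⟩ -
    have h : (x ∘ (i.succAbove j).succAbove) ∘ (j.predAbove i).succAbove =
        (x ∘ i.succAbove) ∘ j.succAbove := by
      funext k
      simp [Fin.succAbove_succAbove_succAbove_predAbove]
    simp only [h, Fin.neg_one_pow_succAbove_add_predAbove, neg_smul, add_neg_cancel]
  · rintro ⟨i, j⟩ - - h
    exact Fin.succAbove_ne i j (congrArg Prod.fst h)
  · simp
  · rintro ⟨i, j⟩ -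
    simp [Fin.succAbove_succAbove_predAbove, Fin.predAbove_predAbove_succAbove]

theorem swap_comp_succAbove_of_lt {n : ℕ} (i : Fin (n + 1)) (j : Fin (n + 2))
    (h : (j : ℕ) < (i : ℕ)) :
    ∃ i' : Fin n, Equiv.swap i.castSucc i.succ ∘ j.succAbove =
      j.succAbove ∘ Equiv.swap i'.castSucc i'.succ := by
  refine ⟨⟨(i : ℕ) - 1, by omega⟩, ?_⟩
  funext a
  simp only [Function.comp_apply, Equiv.swap_apply_def, Fin.succAbove, Fin.ext_iff, Fin.lt_def]
  split_ifs <;> simp_all <;> omega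

theorem swap_comp_succAbove_of_gt {n : ℕ} (i : Fin (n + 1)) (j : Fin (n + 2))
    (h : (i : ℕ) + 1 < (j : ℕ)) :
    ∃ i' : Fin n, Equiv.swap i.castSucc i.succ ∘ j.succAbove =
      j.succAbove ∘ Equiv.swap i'.castSucc i'.succ := by
  refine ⟨⟨(i : ℕ), by omega⟩, ?_⟩
  funext a
  simp only [Function.comp_apply, Equiv.swap_apply_def, Fin.succAbove, Fin.ext_iff, Fin.lt_def]
  split_ifs <;> simp_all <;> omega

theorem swap_comp_succAbove_castSucc {n : ℕ} (i : Fin (n + 1)) :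
    Equiv.swap i.castSucc i.succ ∘ i.castSucc.succAbove = i.succ.succAbove := by
  funext a
  simp only [Function.comp_apply, Equiv.swap_apply_def, Fin.succAbove, Fin.ext_iff, Fin.lt_def]
  split_ifs <;> simp_all <;> omega

theorem swap_comp_succAbove_succ {n : ℕ} (i : Fin (n + 1)) :
    Equiv.swap i.castSucc i.succ ∘ i.succ.succAbove = i.castSucc.succAbove := by
  rw [← swap_comp_succAbove_castSucc, ← Function.comp_assoc, ← Equiv.coe_trans, Equiv.swap_swap]
  rfl

theorem faceSum_comp_swap {n : ℕ} (F : (Fin (n + 1) → G) → A)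
    (hF : ∀ (i : Fin n) (x : Fin (n + 1) → G), F (x ∘ Equiv.swap i.castSucc i.succ) = -F x)
    (i : Fin (n + 1)) (x : Fin (n + 2) → G) :
    faceSum F (x ∘ Equiv.swap i.castSucc i.succ) = -faceSum F x := by
  simp only [faceSum]
  rw [← Equiv.sum_comp (Equiv.swap i.castSucc i.succ)
    (fun j => ((-1 : ℤ) ^ (j : ℕ)) • F (x ∘ j.succAbove)), ← Finset.sum_neg_distrib]
  refine Finset.sum_congr rfl fun j _ => ?_
  rw [Function.comp_assoc]
  by_cases h1 : j = i.castSucc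
  · subst h1
    rw [swap_comp_succAbove_castSucc, Equiv.swap_apply_left]
    simp [pow_succ]
  by_cases h2 : j = i.succ
  · subst h2
    rw [swap_comp_succAbove_succ, Equiv.swap_apply_right]
    simp [pow_succ]
  rw [Equiv.swap_apply_of_ne_of_ne h1 h2]
  simp only [Fin.ext_iff, Fin.val_castSucc, Fin.val_succ] at h1 h2
  obtain ⟨i', h⟩ : ∃ i' : Fin n, Equiv.swap i.castSucc i.succ ∘ j.succAbove =
      j.succAbove ∘ Equiv.swap i'.castSucc i'.succ := by
    rcases lt_or_gt_of_ne h1 with h | h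
    · exact swap_comp_succAbove_of_lt i j h
    · exact swap_comp_succAbove_of_gt i j (by omega)
  rw [h, ← Function.comp_assoc, hF, smul_neg]

end Homogeneous

section Untwisted

variable {k k' : Type*} {G : Type*} [Group G]

/-- The consecutive quotients of a tuple of group elements. -/
def quotients {n : ℕ} (x : Fin (n + 1) → G) : Fin n → G := fun i =>
  (x i.castSucc)⁻¹ * x i.succ

theorem quotients_partialProd {n : ℕ} (g : Fin n → G) : quotients (Fin.partialProd g) = g :=
  funext fun i => Fin.partialProd_right_inv g i

theorem quotients_comp_swap {n : ℕ} (i : Fin n) (x : Fin (n + 1) → G) :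
    quotients (x ∘ Equiv.swap i.castSucc i.succ) = swapTuple i (quotients x) := by
  funext j
  have hne (a : Fin (n + 1)) (h0 : (a : ℕ) ≠ i) (h1 : (a : ℕ) ≠ i + 1) :
      Equiv.swap i.castSucc i.succ a = a :=
    Equiv.swap_apply_of_ne_of_ne (fun h => h0 (congrArg Fin.val h)) fun h => h1 (congrArg Fin.val h)
  simp only [quotients, swapTuple, Function.comp_apply]
  rcases lt_trichotomy (j : ℕ) i with h | h | h
  · have hj : j ≠ i := fun e => h.ne (congrArg Fin.val e)
    rw [hne j.castSucc (by simp; omega) (by simp; omega)]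
    by_cases h' : (j : ℕ) + 1 = i
    · have e : j.succ = i.castSucc := Fin.ext h'
      rw [if_pos h', e, Equiv.swap_apply_left]
      group
    · rw [if_neg h', if_neg hj, if_neg (by omega), hne j.succ (by simp; omega) (by simp; omega)]
  · obtain rfl : j = i := Fin.ext h
    rw [if_neg (by omega), if_pos rfl, Equiv.swap_apply_left, Equiv.swap_apply_right]
    group
  · have hj : j ≠ i := fun e => h.ne' (congrArg Fin.val e)
    rw [if_neg (by omega), if_neg hj, hne j.succ (by simp; omega) (by simp; omega)]
    by_cases h' : (j : ℕ) = i + 1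
    · have e : j.castSucc = i.succ := Fin.ext h'
      rw [if_pos h', e, Equiv.swap_apply_right]
      group
    · rw [if_neg h', hne j.castSucc (by simp; omega) (by simp; omega)]

theorem quotients_comp_succAbove_zero {n : ℕ} (x : Fin (n + 2) → G) :
    quotients (x ∘ (0 : Fin (n + 2)).succAbove) = fun j => quotients x j.succ := by
  funext j
  simp [quotients]

theorem quotients_comp_succAbove_last {n : ℕ} (x : Fin (n + 2) → G) :
    quotients (x ∘ (Fin.last (n + 1)).succAbove) = fun j => quotients x j.castSucc := by
  funext j
  simp [quotients]

theorem quotients_comp_succAbove {n : ℕ} (x : Fin (n + 2) → G) (j : Fin n) :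
    quotients (x ∘ j.castSucc.succ.succAbove) = mergeAt (quotients x) j := by
  funext l
  simp only [quotients, mergeAt, Function.comp_apply]
  rcases lt_trichotomy (l : ℕ) j with h | h | h
  · rw [if_pos h, Fin.succAbove_of_castSucc_lt _ _ (Fin.lt_def.2 (by simp; omega)),
      Fin.succAbove_of_castSucc_lt _ _ (Fin.lt_def.2 (by simp; omega))]
    rfl
  · rw [if_neg h.not_lt, if_pos (Fin.ext h),
      Fin.succAbove_of_castSucc_lt _ _ (Fin.lt_def.2 (by simp; omega)),
      Fin.succAbove_of_le_castSucc _ _ (Fin.le_def.2 (by simp; omega))]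
    simp [mul_assoc]
  · rw [if_neg h.not_gt, if_neg (fun e => h.ne (by rw [e])),
      Fin.succAbove_of_le_castSucc _ _ (Fin.le_def.2 (by simp; omega)),
      Fin.succAbove_of_le_castSucc _ _ (Fin.le_def.2 (by simp; omega))]
    rfl

/-- The homogeneous cochain attached to a Hochschild cochain of the group algebra. -/
def homogenize {n : ℕ} (φ : (Fin n → G) → (G → k)) : (Fin (n + 1) → G) → (G → k) :=
  fun x y => φ (quotients x) ((x 0)⁻¹ * y * x (Fin.last n))

theorem homogenize_injective {n : ℕ} :
    Function.Injective (homogenize : ((Fin n → G) → (G → k)) → _) := by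
  intro φ ψ h
  funext g y
  have := congrFun (congrFun h (Fin.partialProd g)) (y * (Fin.partialProd g (Fin.last n))⁻¹)
  simpa [homogenize, quotients_partialProd] using this

variable [CommRing k] [CommRing k']

/-- The Hochschild differential of the untwisted group algebra. -/
abbrev hD {n : ℕ} (φ : (Fin n → G) → (G → k)) : (Fin (n + 1) → G) → (G → k) :=
  hDiff (fun _ _ => (1 : kˣ)) (Lmul fun _ _ => (1 : kˣ)) (Rmul fun _ _ => (1 : kˣ)) φ

/-- The action of a transposition on Hochschild cochains of the untwisted group algebra. -/
abbrev hS {n : ℕ} (i : Fin n) (φ : (Fin n → G) → (G → k)) : (Fin n → G) → (G → k) :=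
  hSigma (fun _ _ => (1 : kˣ)) (Lmul fun _ _ => (1 : kˣ)) (Rmul fun _ _ => (1 : kˣ)) i φ

theorem hD_apply {n : ℕ} (φ : (Fin n → G) → (G → k)) (g : Fin (n + 1) → G) (y : G) :
    hD φ g y = φ (fun j => g j.succ) ((g 0)⁻¹ * y)
      + ∑ j : Fin n, ((-1 : ℤ) ^ ((j : ℕ) + 1)) • φ (mergeAt g j) y
      + ((-1 : ℤ) ^ (n + 1)) • φ (fun j => g j.castSucc) (y * (g (Fin.last n))⁻¹) := by
  simp [hDiff, Lmul, Rmul]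

theorem hS_apply {n : ℕ} (i : Fin n) (φ : (Fin n → G) → (G → k)) (g : Fin n → G) (y : G) :
    hS i φ g y = -φ (swapTuple i g)
      ((if (i : ℕ) = 0 then (g i)⁻¹ else 1) * y * (if (i : ℕ) + 1 = n then (g i)⁻¹ else 1)) := by
  simp only [hSigma, Lmul, Rmul]
  split_ifs <;> simp

theorem homogenize_hD {n : ℕ} (φ : (Fin n → G) → (G → k)) :
    homogenize (hD φ) = faceSum (homogenize φ) := by
  funext x y
  simp only [homogenize, hD_apply, faceSum, Finset.sum_apply, Pi.smul_apply]
  rw [Fin.sum_univ_succ, Fin.sum_univ_castSucc, quotients_comp_succAbove_zero, Fin.succ_last,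
    quotients_comp_succAbove_last, ← add_assoc]
  congr 1
  · congr 1
    · simp [quotients, mul_assoc]
    · refine Finset.sum_congr rfl fun j _ => ?_
      rw [quotients_comp_succAbove]
      simp
  · simp [quotients, mul_assoc]

theorem homogenize_hS {n : ℕ} (i : Fin n) (φ : (Fin n → G) → (G → k)) (x : Fin (n + 1) → G) :
    homogenize (hS i φ) x = -homogenize φ (x ∘ Equiv.swap i.castSucc i.succ) := by
  funext y
  simp only [homogenize, hS_apply, Pi.neg_apply, quotients_comp_swap]
  congr 2
  have h0 : (if (i : ℕ) = 0 then (quotients x i)⁻¹ else 1) * (x 0)⁻¹ =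
      ((x ∘ Equiv.swap i.castSucc i.succ) 0)⁻¹ := by
    split_ifs with h
    · have : i.castSucc = 0 := Fin.ext h
      simp [quotients, ← this]
    · rw [Function.comp_apply, Equiv.swap_apply_of_ne_of_ne, one_mul] <;>
        simp [Fin.ext_iff] <;> omega
  have h1 : x (Fin.last n) * (if (i : ℕ) + 1 = n then (quotients x i)⁻¹ else 1) =
      (x ∘ Equiv.swap i.castSucc i.succ) (Fin.last n) := by
    split_ifs with h
    · have : i.succ = Fin.last n := Fin.ext h
      simp [quotients, ← this]
    · rw [Function.comp_apply, Equiv.swap_apply_of_ne_of_ne, mul_one] <;>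
        simp [Fin.ext_iff] <;> omega
  rw [← h0, ← h1]
  simp only [mul_assoc]

theorem hD_hD {n : ℕ} (φ : (Fin n → G) → (G → k)) : hD (hD φ) = 0 := by
  apply homogenize_injective
  rw [homogenize_hD, homogenize_hD, faceSum_faceSum]
  rfl

theorem hS_hD {n : ℕ} (φ : (Fin n → G) → (G → k)) (hφ : ∀ i, hS i φ = φ) (i : Fin (n + 1)) :
    hS i (hD φ) = hD φ := by
  apply homogenize_injective
  funext x
  rw [homogenize_hS, homogenize_hD, faceSum_comp_swap, neg_neg]
  intro j z
  conv_rhs => rw [← hφ j]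
  rw [homogenize_hS, neg_neg]

theorem hD_map (f : k →+ k') {n : ℕ} (φ : (Fin n → G) → (G → k)) (g : Fin (n + 1) → G) (y : G) :
    hD (fun g y => f (φ g y)) g y = f (hD φ g y) := by
  simp only [hD_apply, map_add, map_sum, map_zsmul]

theorem hS_map (f : k → k') (hf : ∀ a, f (-a) = -f a) {n : ℕ} (i : Fin n)
    (φ : (Fin n → G) → (G → k)) (g : Fin n → G) (y : G) :
    hS i (fun g y => f (φ g y)) g y = f (hS i φ g y) := by
  simp [hS_apply, hf]

theorem hD_add {n : ℕ} (φ ψ : (Fin n → G) → (G → k)) : hD (φ + ψ) = hD φ + hD ψ := by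
  funext g y
  simp only [hD_apply, Pi.add_apply, smul_add, Finset.sum_add_distrib]
  abel

theorem hD_sub {n : ℕ} (φ ψ : (Fin n → G) → (G → k)) : hD (φ - ψ) = hD φ - hD ψ := by
  funext g y
  simp only [hD_apply, Pi.sub_apply, smul_sub, Finset.sum_sub_distrib]
  abel

theorem hD_zero {n : ℕ} : hD (0 : (Fin n → G) → (G → k)) = 0 := by
  funext g y
  simp [hD_apply]

theorem hS_add {n : ℕ} (i : Fin n) (φ ψ : (Fin n → G) → (G → k)) :
    hS i (φ + ψ) = hS i φ + hS i ψ := by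
  funext g y
  simp only [hS_apply, Pi.add_apply]
  abel

theorem hS_sub {n : ℕ} (i : Fin n) (φ ψ : (Fin n → G) → (G → k)) :
    hS i (φ - ψ) = hS i φ - hS i ψ := by
  funext g y
  simp only [hS_apply, Pi.sub_apply]
  abel

theorem prod_ofFn_mergeAt {n : ℕ} (g : Fin (n + 1) → G) (j : Fin n) :
    (List.ofFn (mergeAt g j)).prod = (List.ofFn g).prod := by
  have h := congrArg (fun f => f (Fin.last n)) (Fin.partialProd_contractNth g j.castSucc)
  have e : Fin.contractNth j.castSucc (· * ·) g = mergeAt g j := by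
    funext l
    simp [Fin.contractNth, mergeAt, Fin.ext_iff]
  rw [e, Function.comp_apply, Fin.succAbove_of_le_castSucc _ _ (by simp [Fin.le_def]),
    Fin.succ_last] at h
  simp only [Fin.partialProd, Fin.val_last] at h
  rwa [List.take_of_length_le (by simp), List.take_of_length_le (by simp)] at h

theorem rinvs_one_apply (l : List G) (v : G → k) (y : G) :
    rinvs (fun _ _ => (1 : kˣ)) l v y = v (y * l.prod) := by
  induction l generalizing y with
  | nil => simp [rinvs]
  | cons a l ih =>
    have : rinvs (fun _ _ => (1 : kˣ)) (a :: l) v y =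
        rinvs (fun _ _ => (1 : kˣ)) l v (y * a) := by
      simp [rinvs, Rmul]
    rw [this, ih, List.prod_cons, mul_assoc]

theorem piC_one_apply (x : G) {n : ℕ} (φ : (Fin n → G) → (G → k))
    (h : Fin n → Subgroup.centralizer ({x} : Set G)) :
    piC (fun _ _ => (1 : kˣ)) x φ h =
      φ (fun i => (h i : G)) (x * (List.ofFn fun i => (h i : G)).prod) :=
  rinvs_one_apply _ _ _

theorem piC_hD (x : G) {n : ℕ} (φ : (Fin n → G) → (G → k)) :
    piC (fun _ _ => (1 : kˣ)) x (hD φ) =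
      cDiff (fun _ : Subgroup.centralizer ({x} : Set G) => (1 : k))
        (piC (fun _ _ => (1 : kˣ)) x φ) := by
  funext h
  have hx : x * (h 0 : G) = h 0 * x :=
    Subgroup.mem_centralizer_iff.mp (h 0).2 x rfl
  have hm (j : Fin n) : (fun i => ((mergeAt h j i : Subgroup.centralizer ({x} : Set G)) : G)) =
      mergeAt (fun i => (h i : G)) j := by
    funext i
    simp only [mergeAt]
    split_ifs <;> rfl
  simp only [cDiff, piC_one_apply, hD_apply, one_mul, hm, prod_ofFn_mergeAt]
  congr 2
  · rw [List.ofFn_succ, List.prod_cons, ← mul_assoc x, hx]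
    simp [mul_assoc]
  · rw [List.ofFn_succ', List.concat_eq_append, List.prod_append]
    simp [mul_assoc]

theorem cDiff_zero {H : Type*} [Group H] (χ : H → k) {n : ℕ} :
    cDiff χ (0 : (Fin n → H) → k) = 0 := by
  funext h
  simp [cDiff]

theorem cSigma_zero {H : Type*} [Group H] (χ : H → k) {n : ℕ} (i : Fin n) :
    cSigma χ i (0 : (Fin n → H) → k) = 0 := by
  funext h
  simp [cSigma]

end Untwisted

/-- given a short exact sequence `0 → k₁ → k₂ → k₃ → 0` of the additive
groups of commutative rings with a symmetric section `s`, (i) the assignment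
`φ ↦ 𝔹(φ) = r_{ι_G} ∘ δ_{k₂G}(s_{π_G} ∘ φ)` sends symmetric Hochschild cocycles of
`k₃G` to symmetric Hochschild cocycles of `k₁G` and induces a well-defined group
homomorphism `𝔹_G^n : HHS^n(k₃G) → HHS^{n+1}(k₁G)` (the connecting homomorphism in
symmetric Hochschild cohomology); (ii) for every `x ∈ G` the square with the
connecting homomorphism `β^{n,S}_{C_G(x)} : HS^n(C_G(x),k₃x) → HS^{n+1}(C_G(x),k₁x)`
and the maps `π^{n,S}_{G,x}` commutes on cohomology. -/
theorem connecting_hom_hochschild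
    {G : Type*} [Group G] [Fintype G] [DecidableEq G]
    {k1 k2 k3 : Type*} [CommRing k1] [CommRing k2] [CommRing k3]
    (ι : k1 → k2) (π : k2 → k3)
    (hιadd : ∀ a a', ι (a + a') = ι a + ι a') (hπadd : ∀ b b', π (b + b') = π b + π b')
    (hιinj : Function.Injective ι) (hπsurj : Function.Surjective π)
    (hexact : ∀ b : k2, π b = 0 ↔ ∃ a : k1, ι a = b)
    (s : k3 → k2) (hs : ∀ c, π (s c) = c) (hssym : ∀ c, s (-c) = -s c)
    (r : k2 → k1) (hr1 : ∀ a, r (ι a) = a) (hr2 : ∀ b, π b = 0 → ι (r b) = b)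
    {n : ℕ} (φ : (Fin n → G) → (G → k3))
    (hφsym : ∀ i0 : Fin n,
      hSigma (fun _ _ => (1 : k3ˣ)) (Lmul fun _ _ => (1 : k3ˣ)) (Rmul fun _ _ => (1 : k3ˣ)) i0 φ = φ)
    (hφ : hDiff (fun _ _ => (1 : k3ˣ)) (Lmul fun _ _ => (1 : k3ˣ)) (Rmul fun _ _ => (1 : k3ˣ)) φ = 0) :
    -- 𝔹(φ) is a symmetric Hochschild cochain of k₁G
    (∀ i0 : Fin (n + 1),
      hSigma (fun _ _ => (1 : k1ˣ)) (Lmul fun _ _ => (1 : k1ˣ)) (Rmul fun _ _ => (1 : k1ˣ)) i0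
        (fun g y => r (hDiff (fun _ _ => (1 : k2ˣ)) (Lmul fun _ _ => (1 : k2ˣ))
          (Rmul fun _ _ => (1 : k2ˣ)) (fun g' y' => s (φ g' y')) g y)) =
      fun g y => r (hDiff (fun _ _ => (1 : k2ˣ)) (Lmul fun _ _ => (1 : k2ˣ))
        (Rmul fun _ _ => (1 : k2ˣ)) (fun g' y' => s (φ g' y')) g y)) ∧
    -- 𝔹(φ) is a Hochschild cocycle
    (hDiff (fun _ _ => (1 : k1ˣ)) (Lmul fun _ _ => (1 : k1ˣ)) (Rmul fun _ _ => (1 : k1ˣ))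
      (fun g y => r (hDiff (fun _ _ => (1 : k2ˣ)) (Lmul fun _ _ => (1 : k2ˣ))
        (Rmul fun _ _ => (1 : k2ˣ)) (fun g' y' => s (φ g' y')) g y)) = 0) ∧
    -- [φ] ↦ [𝔹(φ)] is well defined on symmetric Hochschild cohomology
    (∀ φ' : (Fin n → G) → (G → k3),
      (∀ i0 : Fin n,
        hSigma (fun _ _ => (1 : k3ˣ)) (Lmul fun _ _ => (1 : k3ˣ)) (Rmul fun _ _ => (1 : k3ˣ)) i0 φ' = φ') →
      hDiff (fun _ _ => (1 : k3ˣ)) (Lmul fun _ _ => (1 : k3ˣ)) (Rmul fun _ _ => (1 : k3ˣ)) φ' = 0 →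
      IsHSCoboundary (fun _ _ => (1 : k3ˣ)) (Lmul fun _ _ => (1 : k3ˣ)) (Rmul fun _ _ => (1 : k3ˣ))
        (φ - φ') →
      IsHSCoboundary (fun _ _ => (1 : k1ˣ)) (Lmul fun _ _ => (1 : k1ˣ)) (Rmul fun _ _ => (1 : k1ˣ))
        ((fun g y => r (hDiff (fun _ _ => (1 : k2ˣ)) (Lmul fun _ _ => (1 : k2ˣ))
            (Rmul fun _ _ => (1 : k2ˣ)) (fun g' y' => s (φ g' y')) g y)) -
         fun g y => r (hDiff (fun _ _ => (1 : k2ˣ)) (Lmul fun _ _ => (1 : k2ˣ))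
            (Rmul fun _ _ => (1 : k2ˣ)) (fun g' y' => s (φ' g' y')) g y)) ) ∧
    -- [φ] ↦ [𝔹(φ)] is additive on symmetric Hochschild cohomology
    (∀ φ' : (Fin n → G) → (G → k3),
      (∀ i0 : Fin n,
        hSigma (fun _ _ => (1 : k3ˣ)) (Lmul fun _ _ => (1 : k3ˣ)) (Rmul fun _ _ => (1 : k3ˣ)) i0 φ' = φ') →
      hDiff (fun _ _ => (1 : k3ˣ)) (Lmul fun _ _ => (1 : k3ˣ)) (Rmul fun _ _ => (1 : k3ˣ)) φ' = 0 →
      IsHSCoboundary (fun _ _ => (1 : k1ˣ)) (Lmul fun _ _ => (1 : k1ˣ)) (Rmul fun _ _ => (1 : k1ˣ))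
        ((fun g y => r (hDiff (fun _ _ => (1 : k2ˣ)) (Lmul fun _ _ => (1 : k2ˣ))
            (Rmul fun _ _ => (1 : k2ˣ)) (fun g' y' => s (φ g' y' + φ' g' y')) g y)) -
         (fun g y => r (hDiff (fun _ _ => (1 : k2ˣ)) (Lmul fun _ _ => (1 : k2ˣ))
            (Rmul fun _ _ => (1 : k2ˣ)) (fun g' y' => s (φ g' y')) g y)) -
         fun g y => r (hDiff (fun _ _ => (1 : k2ˣ)) (Lmul fun _ _ => (1 : k2ˣ))
            (Rmul fun _ _ => (1 : k2ˣ)) (fun g' y' => s (φ' g' y')) g y)) ) ∧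
    -- the square `π^{n+1,S}_{G,x} ∘ 𝔹_G^n = β^{n,S}_{C_G(x)} ∘ π^{n,S}_{G,x}` commutes
    (∀ x : G,
      IsCSCoboundary (fun _ : Subgroup.centralizer ({x} : Set G) => (1 : k1))
        (piC (fun _ _ => (1 : k1ˣ)) x
          (fun g y => r (hDiff (fun _ _ => (1 : k2ˣ)) (Lmul fun _ _ => (1 : k2ˣ))
            (Rmul fun _ _ => (1 : k2ˣ)) (fun g' y' => s (φ g' y')) g y)) -
         fun h => r (cDiff (fun _ : Subgroup.centralizer ({x} : Set G) => (1 : k2))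
           (fun h' => s (piC (fun _ _ => (1 : k3ˣ)) x φ h')) h)) ) := by
  let ι' : k1 →+ k2 := AddMonoidHom.mk' ι hιadd
  let π' : k2 →+ k3 := AddMonoidHom.mk' π hπadd
  have hπs (c : k3) : π' (s c) = c := hs c
  have hιr (b : k2) (hb : π' b = 0) : ι' (r b) = b := hr2 b hb
  have hι_ext {m : ℕ} {u v : (Fin m → G) → (G → k1)}
      (h : ∀ g y, ι' (u g y) = ι' (v g y)) : u = v :=
    funext₂ fun g y => hιinj (h g y)
  have hι0 (a : k1) : ι' (-a) = -ι' a := map_neg _ _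
  have hs_symm {m : ℕ} (θ : (Fin m → G) → (G → k3)) (hθ : ∀ i, hS i θ = θ) (i : Fin m) :
      hS i (fun g y => s (θ g y)) = fun g y => s (θ g y) := by
    funext g y
    rw [hS_map s hssym, hθ]
  -- The connecting map on cocycles, characterized by its image under `ι`.
  have hB (θ : (Fin n → G) → (G → k3)) (hθ : hD θ = 0) (g : Fin (n + 1) → G) (y : G) :
      ι' (r (hD (fun g' y' => s (θ g' y')) g y)) = hD (fun g' y' => s (θ g' y')) g y := by
    apply hιr
    rw [← hD_map]
    simp only [hπs]
    exact congrFun₂ hθ g y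
  -- A symmetric cochain over `k2` in the kernel of `π` lifts to a symmetric cochain over `k1`.
  have hlift {m : ℕ} (u : (Fin m → G) → (G → k2)) (hu : ∀ i, hS i u = u)
      (hu0 : ∀ g y, π' (u g y) = 0) :
      ∃ η : (Fin m → G) → (G → k1), (∀ i, hS i η = η) ∧ (fun g y => ι' (η g y)) = u := by
    have e : (fun g y => ι' (r (u g y))) = u := funext₂ fun g y => hιr _ (hu0 g y)
    refine ⟨fun g y => r (u g y), fun i => hι_ext fun g y => ?_, e⟩
    rw [← hS_map ι' hι0, e, hu, hιr _ (hu0 g y)]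
  refine ⟨fun i => hι_ext fun g y => ?_, hι_ext fun g y => ?_, fun φ' hφ's hφ' hcob => ?_,
    fun φ' hφ's hφ' => ?_, fun x => ?_⟩
  · rw [hB φ hφ]
    refine (hS_map ι' hι0 i _ g y).symm.trans ?_
    simp only [hB φ hφ]
    exact congrFun₂ (hS_hD _ (hs_symm φ hφsym) i) g y
  · refine (hD_map ι' _ g y).symm.trans ?_
    simp only [hB φ hφ, Pi.zero_apply, map_zero]
    exact congrFun₂ (hD_hD _) g y
  · obtain ⟨w, hw, hwD, hwπ⟩ : ∃ w : (Fin n → G) → (G → k2), (∀ i, hS i w = w) ∧ hD w = 0 ∧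
        ∀ g y, π' (w g y) = φ g y - φ' g y := by
      cases n with
      | zero =>
        refine ⟨0, fun i => i.elim0, hD_zero, fun g y => ?_⟩
        simpa using (congrFun₂ (show φ - φ' = 0 from hcob) g y).symm
      | succ m =>
        obtain ⟨θ, hθs, hθ⟩ := hcob
        refine ⟨hD fun g y => s (θ g y), hS_hD _ (hs_symm θ hθs), hD_hD _, fun g y => ?_⟩
        rw [← hD_map]
        simp only [hπs]
        exact (congrFun₂ hθ g y).symm
    obtain ⟨η, hηs, hη⟩ := hlift
      ((fun g y => s (φ g y)) - (fun g y => s (φ' g y)) - w)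
      (fun i => by rw [hS_sub, hS_sub, hw, hs_symm φ hφsym, hs_symm φ' hφ's])
      (fun g y => by simp [hπs, hwπ])
    refine ⟨η, hηs, hι_ext fun g y => ?_⟩
    refine Eq.trans ?_ (hD_map ι' η g y)
    rw [hη, hD_sub, hD_sub, hwD, sub_zero]
    simp only [Pi.sub_apply, map_sub]
    rw [hB φ hφ, hB φ' hφ']
  · have hadd : hD (φ + φ') = 0 :=
      (hD_add φ φ').trans ((congrArg₂ (· + ·) hφ hφ').trans (add_zero 0))
    have hadds (i : Fin n) : hS i (φ + φ') = φ + φ' :=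
      (hS_add i φ φ').trans (congrArg₂ (· + ·) (hφsym i) (hφ's i))
    obtain ⟨η, hηs, hη⟩ := hlift
      ((fun g y => s ((φ + φ') g y)) - (fun g y => s (φ g y)) - (fun g y => s (φ' g y)))
      (fun i => by rw [hS_sub, hS_sub, hs_symm _ hadds, hs_symm φ hφsym, hs_symm φ' hφ's])
      (fun g y => by simp [hπs])
    refine ⟨η, hηs, hι_ext fun g y => ?_⟩
    refine Eq.trans ?_ (hD_map ι' η g y)
    rw [hη, hD_sub, hD_sub]
    simp only [Pi.sub_apply, map_sub]
    rw [hB φ hφ, hB φ' hφ']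
    exact congrArg (· - _ - _) (hB (φ + φ') hadd g y)
  · refine ⟨0, fun i => cSigma_zero _ i, ?_⟩
    rw [cDiff_zero, sub_eq_zero]
    funext h
    rw [piC_one_apply]
    have e := congrFun (piC_hD x fun g y => s (φ g y)) h
    rw [piC_one_apply] at e
    refine congrArg r (e.trans ?_)
    congr 1
    funext h'
    rw [piC_one_apply, piC_one_apply]

end TwistedSym
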